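/- arXiv:2512.18238 — 3 statements merged into one kernel-verified Lean document; each statement's English description precedes it below -/
import Mathlib

section
/- Let m ≥ 1, let T be a finite set of m-tuples that are pairwise non-conflicting with |T| = N, and let R be a finite set of m-tuples such that every t ∈ T either belongs to R or conflicts with some member of R. Then N ≤ m·|R|, and consequently |R| ≥ ⌈N/m⌉. -/
/-- Let `m ≥ 1`, `T` a finite set of pairwise non-conflicting m-tuples with
`|T| = N`, and `R` a finite set of m-tuples such that every `t ∈ T` either
belongs to `R` or conflicts with some member of `R`. Then `N ≤ m·|R|`, and
consequently `|R| ≥ ⌈N/m⌉`. -/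
theorem stmt_2 (m N : ℕ) (hm : 1 ≤ m) (T R : Finset (Fin m → ℕ))
    (hT : ∀ t₁ ∈ T, ∀ t₂ ∈ T, t₁ ≠ t₂ → ∀ k : Fin m, t₁ k ≠ t₂ k)
    (hN : T.card = N)
    (hmax : ∀ t ∈ T, t ∈ R ∨ ∃ r ∈ R, ∃ k : Fin m, t k = r k) :
    N ≤ m * R.card ∧ (⌈(N : ℚ) / (m : ℚ)⌉ : ℤ) ≤ (R.card : ℤ) := by
  have hblock : ∀ t ∈ T, ∃ p : Fin m × (Fin m → ℕ), p.2 ∈ R ∧ t p.1 = p.2 p.1 := by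
    intro t ht
    rcases hmax t ht with h | ⟨r, hr, k, hk⟩
    · exact ⟨(⟨0, hm⟩, t), h, rfl⟩
    · exact ⟨(k, r), hr, hk⟩
  have : Nonempty (Fin m) := ⟨⟨0, hm⟩⟩
  choose! f hfR hf using hblock
  have hcard : N ≤ m * R.card := by
    have h : T.card ≤ ((Finset.univ : Finset (Fin m)) ×ˢ R).card := by
      refine Finset.card_le_card_of_injOn f
        (fun t ht => by simpa using hfR t ht) (fun t₁ h₁ t₂ h₂ h => ?_)
      by_contra hne
      exact hT t₁ h₁ t₂ h₂ hne (f t₁).1 (by rw [hf t₁ h₁, h, hf t₂ h₂])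
    simpa [hN] using h
  refine ⟨hcard, Int.ceil_le.mpr ?_⟩
  have hm' : (0 : ℚ) < m := by exact_mod_cast hm
  rw [div_le_iff₀ hm', mul_comm]
  exact_mod_cast hcard
end

section
/- Let m ≥ 1 and let C be a finite set of m-tuples. Let W : (Fin m → ℕ) → ℝ be a weight function and W_min, W_max reals with 0 < W_min and W_min ≤ W(c) ≤ W_max for every c ∈ C. Let T ⊆ C be pairwise non-conflicting with |T| = N ≥ 1, and let R ⊆ C be a set of m-tuples such that every c ∈ C either belongs to R or conflicts with some member of R. Then the total weight of R satisfies ∑_{r ∈ R} W(r) ≥ (⌈N/m⌉ · W_min) / (N · W_max) · ∑_{t ∈ T} W(t). -/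
/-- If every tuple of a pairwise non-conflicting set `T` agrees in some column with a member of `R`,
then `T` has at most `m` times as many elements as `R`. -/
theorem card_le_card_mul_of_nonconflicting {m : ℕ} {T R : Finset (Fin m → ℕ)}
    (hT : ∀ t₁ ∈ T, ∀ t₂ ∈ T, t₁ ≠ t₂ → ∀ k : Fin m, t₁ k ≠ t₂ k)
    (hTR : ∀ t ∈ T, ∃ r ∈ R, ∃ k : Fin m, t k = r k) :
    T.card ≤ R.card * m := by
  have h : T.card ≤ (R ×ˢ (Finset.univ : Finset (Fin m))).card := by
    refine Finset.card_le_card_of_forall_subsingleton (fun t p => t p.2 = p.1 p.2)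
      (fun t ht => ?_) fun p _ a ha b hb => ?_
    · obtain ⟨r, hr, k, hk⟩ := hTR t ht
      exact ⟨(r, k), by simpa using hr, hk⟩
    · by_contra hne
      exact hT a ha.1 b hb.1 hne p.2 (ha.2.trans hb.2.symm)
  simpa using h

/-- **Proposition 2 (abstract form).** Let `m ≥ 1` and `C` a finite set of
m-tuples, `W` a weight function with `0 < W_min` and
`W_min ≤ W c ≤ W_max` on `C`. Let `T ⊆ C` be pairwise non-conflicting with
`|T| = N ≥ 1`, and let `R ⊆ C` be such that every `c ∈ C` either belongs to
`R` or conflicts with some member of `R`. Then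
`∑_{r ∈ R} W r ≥ (⌈N/m⌉·W_min)/(N·W_max) · ∑_{t ∈ T} W t`. -/
theorem stmt_3 (m N : ℕ) (hm : 1 ≤ m) (C T R : Finset (Fin m → ℕ))
    (W : (Fin m → ℕ) → ℝ) (Wmin Wmax : ℝ)
    (hWmin : 0 < Wmin)
    (hW : ∀ c ∈ C, Wmin ≤ W c ∧ W c ≤ Wmax)
    (hTC : T ⊆ C)
    (hT : ∀ t₁ ∈ T, ∀ t₂ ∈ T, t₁ ≠ t₂ → ∀ k : Fin m, t₁ k ≠ t₂ k)
    (hN : T.card = N) (hN1 : 1 ≤ N)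
    (hRC : R ⊆ C)
    (hmax : ∀ c ∈ C, c ∈ R ∨ ∃ r ∈ R, ∃ k : Fin m, c k = r k) :
    ∑ r ∈ R, W r ≥
      ((⌈(N : ℝ) / (m : ℝ)⌉ : ℝ) * Wmin) / ((N : ℝ) * Wmax) * ∑ t ∈ T, W t := by
  have hcard : N ≤ R.card * m := hN ▸ card_le_card_mul_of_nonconflicting hT fun t ht =>
    (hmax t (hTC ht)).elim (fun h => ⟨t, h, ⟨0, hm⟩, rfl⟩) id
  have hm0 : (0 : ℝ) < m := by exact_mod_cast hm
  have hN0 : (0 : ℝ) < N := by exact_mod_cast hN1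
  obtain ⟨t, ht⟩ : T.Nonempty := Finset.card_pos.mp (by omega)
  have hWmax : 0 < Wmax := hWmin.trans_le ((hW t (hTC ht)).1.trans (hW t (hTC ht)).2)
  have hceil : (⌈(N : ℝ) / (m : ℝ)⌉ : ℝ) ≤ R.card := by
    have h : ⌈(N : ℝ) / (m : ℝ)⌉ ≤ (R.card : ℤ) := by
      rw [Int.ceil_le, div_le_iff₀ hm0]
      exact_mod_cast hcard
    exact_mod_cast h
  have hceil0 : (0 : ℝ) ≤ ⌈(N : ℝ) / (m : ℝ)⌉ := by
    exact_mod_cast Int.ceil_nonneg (div_nonneg hN0.le hm0.le)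
  have hsumT : ∑ t ∈ T, W t ≤ N * Wmax := by
    simpa [hN] using Finset.sum_le_card_nsmul T W Wmax fun t ht => (hW t (hTC ht)).2
  have hsumR : R.card * Wmin ≤ ∑ r ∈ R, W r := by
    simpa using Finset.card_nsmul_le_sum R W Wmin fun r hr => (hW r (hRC hr)).1
  calc ((⌈(N : ℝ) / (m : ℝ)⌉ : ℝ) * Wmin) / ((N : ℝ) * Wmax) * ∑ t ∈ T, W t
      ≤ ((⌈(N : ℝ) / (m : ℝ)⌉ : ℝ) * Wmin) / ((N : ℝ) * Wmax) * (N * Wmax) :=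
        mul_le_mul_of_nonneg_left hsumT
          (div_nonneg (mul_nonneg hceil0 hWmin.le) (mul_pos hN0 hWmax).le)
    _ = ⌈(N : ℝ) / (m : ℝ)⌉ * Wmin := div_mul_cancel₀ _ (mul_pos hN0 hWmax).ne'
    _ ≤ R.card * Wmin := mul_le_mul_of_nonneg_right hceil hWmin.le
    _ ≤ ∑ r ∈ R, W r := hsumR
end

section
/- Let m ≥ 1, N ≥ 1, l be natural numbers with l ≥ ⌈N/m⌉, and let W_min, W_max, W_E, W_O, w be reals with 0 < W_min ≤ W_max and W_O > 0. Suppose W_E ≥ (l − 1)·W_min + w, and suppose that at least one of the following two cases holds: (Case 1) w ≥ W_min and W_O ≤ (N − 1)·W_max + W_min; (Case 2) w ≥ 2·W_min and W_O ≤ N·W_max. Then W_E / W_O ≥ min( (⌈N/m⌉ + 1)·W_min / (N·W_max), ⌈N/m⌉·W_min / ((N − 1)·W_max + W_min) ). -/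
/-- **Arithmetic core of Proposition 3.** Let `m ≥ 1`, `N ≥ 1`, `l` be
naturals with `l ≥ ⌈N/m⌉` and `W_min, W_max, W_E, W_O, w` reals with
`0 < W_min ≤ W_max` and `W_O > 0`. Suppose `W_E ≥ (l−1)·W_min + w`, and that
either (Case 1) `w ≥ W_min` and `W_O ≤ (N−1)·W_max + W_min`, or
(Case 2) `w ≥ 2·W_min` and `W_O ≤ N·W_max`. Then
`W_E/W_O ≥ min((⌈N/m⌉+1)·W_min/(N·W_max), ⌈N/m⌉·W_min/((N−1)·W_max + W_min))`. -/
theorem stmt_4 (m N l : ℕ) (hm : 1 ≤ m) (hN : 1 ≤ N)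
    (Wmin Wmax WE WO w : ℝ)
    (hWmin : 0 < Wmin) (hWminmax : Wmin ≤ Wmax) (hWO : 0 < WO)
    (hl : (⌈(N : ℝ) / (m : ℝ)⌉ : ℤ) ≤ (l : ℤ))
    (hWE : WE ≥ ((l : ℝ) - 1) * Wmin + w)
    (hcase : (w ≥ Wmin ∧ WO ≤ ((N : ℝ) - 1) * Wmax + Wmin) ∨
             (w ≥ 2 * Wmin ∧ WO ≤ (N : ℝ) * Wmax)) :
    WE / WO ≥
      min (((⌈(N : ℝ) / (m : ℝ)⌉ : ℝ) + 1) * Wmin / ((N : ℝ) * Wmax))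
          ((⌈(N : ℝ) / (m : ℝ)⌉ : ℝ) * Wmin / (((N : ℝ) - 1) * Wmax + Wmin)) := by
  have hceil : (0 : ℝ) ≤ (⌈(N : ℝ) / (m : ℝ)⌉ : ℝ) := by
    exact_mod_cast Int.ceil_nonneg (by positivity : (0 : ℝ) ≤ (N : ℝ) / (m : ℝ))
  have hl' : (⌈(N : ℝ) / (m : ℝ)⌉ : ℝ) ≤ (l : ℝ) := by exact_mod_cast hl
  have hmul := mul_le_mul_of_nonneg_right hl' hWmin.le
  rcases hcase with ⟨hw, hO⟩ | ⟨hw, hO⟩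
  · exact (min_le_right _ _).trans
      (div_le_div₀ (by nlinarith) (by linarith) hWO hO)
  · exact (min_le_left _ _).trans
      (div_le_div₀ (by nlinarith) (by linarith) hWO hO)
end
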